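/- Assume the Notation 3.2 setup. Then there exist a homogeneous two-sided ideal I of A = K⟨x,y⟩ and, for each n ≥ 1, subspaces L'(n), R'(n) ⊆ A(n) with L(n) ⊕ L'(n) = R(n) ⊕ R'(n) = A(n) (where L(n), R(n) are defined as in Notation 3.2), such that: (1) if J is a homogeneous ideal of A satisfying J ⊆ Σ_k A(k·2^{f(i)})·W_i·A for some natural number i, then J ⊆ I; (2) V(2^n) ⊄ I for every natural number n; (3) I has infinite codimension in A; (4) for every natural number n, dim_K(A(n)/(I ∩ A(n))) ≤ Σ_{j=0}^{n} dim L'(j)·dim R'(n−j). -/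

import Mathlib

open Module

noncomputable section

/-- The free associative algebra `K⟨x,y⟩` on two generators. -/
abbrev FA (K : Type*) [Field K] := FreeAlgebra K (Fin 2)

/-- The element of `K⟨x,y⟩` given by a word (a list of letters). -/
def wordOf (K : Type*) [Field K] (l : List (Fin 2)) : FA K :=
  (l.map (FreeAlgebra.ι K)).prod

/-- `a` is a word of length `n` over the two generators. -/
def IsWord (K : Type*) [Field K] (n : ℕ) (a : FA K) : Prop :=
  ∃ l : List (Fin 2), l.length = n ∧ a = wordOf K l

/-- `A(n)`: the span of all words of length `n`. -/
def Aspan (K : Type*) [Field K] (n : ℕ) : Submodule K (FA K) :=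
  Submodule.span K {a | IsWord K n a}

/-- The set `T = ∪_{i ≥ 1} {f(i)-g(i)-1, …, f(i)-1}`. -/
def Tset (f g : ℕ → ℕ) : Set ℕ :=
  {n | ∃ i, 1 ≤ i ∧ f i ≤ n + g i + 1 ∧ n + 1 ≤ f i}

/-- The data and conditions of Notation 3.2 (with the subspaces `U(2^n)`, `V(2^n)`
satisfying conditions (1)–(8) of Proposition 3.1). Here `U n` and `V n` denote the
subspaces `U(2^n)` and `V(2^n)` of `A(2^n)`. -/
structure LSYSetup (K : Type*) [Field K] where
  f : ℕ → ℕ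
  g : ℕ → ℕ
  W : ℕ → Submodule K (FA K)
  U : ℕ → Submodule K (FA K)
  V : ℕ → Submodule K (FA K)
  /-- `f(i-1) < f(i) - g(i) - 1` for all `i ≥ 1` -/
  hf : ∀ i, 1 ≤ i → f (i - 1) + g i + 1 < f i
  /-- `W_i ⊆ A(2^{f(i)})` -/
  hW_le : ∀ i, 1 ≤ i → W i ≤ Aspan K (2 ^ f i)
  /-- `dim W_i ≤ 2^{2^{g(i)}} - 2` -/
  hW_dim : ∀ i, 1 ≤ i → finrank K (W i) ≤ 2 ^ 2 ^ g i - 2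
  hU_le : ∀ n, U n ≤ Aspan K (2 ^ n)
  hV_le : ∀ n, V n ≤ Aspan K (2 ^ n)
  /-- (1) `U(2^n) ⊕ V(2^n) = A(2^n)` -/
  h_disj : ∀ n, Disjoint (U n) (V n)
  h_sup : ∀ n, U n ⊔ V n = Aspan K (2 ^ n)
  /-- (2) `dim V(2^n) = 2` whenever `n ∉ T` -/
  h_dimV : ∀ n, n ∉ Tset f g → finrank K (V n) = 2
  /-- (3) `dim V(2^{n+j}) = 2^{2^j}` whenever `n = f(i)-g(i)-1` and `0 ≤ j ≤ g(i)` -/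
  h_dimV' : ∀ i j n, 1 ≤ i → n + g i + 1 = f i → j ≤ g i →
      finrank K (V (n + j)) = 2 ^ 2 ^ j
  /-- (4) `V(2^n)` has a basis consisting of words -/
  h_basis : ∀ n, ∃ s : Set (FA K), (∀ w ∈ s, IsWord K (2 ^ n) w) ∧
      LinearIndependent K ((↑) : s → FA K) ∧ Submodule.span K s = V n
  /-- (5) `W_i ⊆ U(2^{f(i)})` -/
  hWU : ∀ i, 1 ≤ i → W i ≤ U (f i)
  /-- (6) `A(2^n)U(2^n) + U(2^n)A(2^n) ⊆ U(2^{n+1})` -/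
  hU_mul : ∀ n, Aspan K (2 ^ n) * U n ⊔ U n * Aspan K (2 ^ n) ≤ U (n + 1)
  /-- (7) `V(2^{n+1}) ⊆ V(2^n)V(2^n)` -/
  hV_mul : ∀ n, V (n + 1) ≤ V n * V n
  /-- (8) if `n ∉ T` then some word `w ∈ V(2^n)` has `w·A(2^n) ⊆ U(2^{n+1})` -/
  h_word : ∀ n, n ∉ Tset f g → ∃ w, IsWord K (2 ^ n) w ∧ w ∈ V n ∧
      ∀ a ∈ Aspan K (2 ^ n), w * a ∈ U (n + 1)

variable {K : Type*} [Field K]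

/-- `R(n) = {a ∈ A(n) : A(2^{m+1}-n)·a ⊆ U(2^{m+1})}`. -/
def Rspace (S : LSYSetup K) (n m : ℕ) : Submodule K (FA K) where
  carrier := {a | a ∈ Aspan K n ∧ ∀ b ∈ Aspan K (2 ^ (m + 1) - n), b * a ∈ S.U (m + 1)}
  add_mem' := by
    rintro a b ⟨ha1, ha2⟩ ⟨hb1, hb2⟩
    exact ⟨add_mem ha1 hb1, fun c hc => by
      rw [mul_add]; exact add_mem (ha2 c hc) (hb2 c hc)⟩
  zero_mem' := ⟨zero_mem _, fun c hc => by rw [mul_zero]; exact zero_mem _⟩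
  smul_mem' := by
    rintro k a ⟨ha1, ha2⟩
    exact ⟨Submodule.smul_mem _ k ha1, fun c hc => by
      rw [mul_smul_comm]; exact Submodule.smul_mem _ _ (ha2 c hc)⟩

/-- `L(n) = {a ∈ A(n) : a·A(2^{m+1}-n) ⊆ U(2^{m+1})}`. -/
def Lspace (S : LSYSetup K) (n m : ℕ) : Submodule K (FA K) where
  carrier := {a | a ∈ Aspan K n ∧ ∀ b ∈ Aspan K (2 ^ (m + 1) - n), a * b ∈ S.U (m + 1)}
  add_mem' := by
    rintro a b ⟨ha1, ha2⟩ ⟨hb1, hb2⟩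
    exact ⟨add_mem ha1 hb1, fun c hc => by
      rw [add_mul]; exact add_mem (ha2 c hc) (hb2 c hc)⟩
  zero_mem' := ⟨zero_mem _, fun c hc => by rw [zero_mul]; exact zero_mem _⟩
  smul_mem' := by
    rintro k a ⟨ha1, ha2⟩
    exact ⟨Submodule.smul_mem _ k ha1, fun c hc => by
      rw [smul_mul_assoc]; exact Submodule.smul_mem _ _ (ha2 c hc)⟩

/-- `I(n) = {a ∈ A(n) : A(j)·a·A(2^{m+2}-j-n) ⊆ U(2^{m+1})A(2^{m+1}) + A(2^{m+1})U(2^{m+1})`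
for all `0 ≤ j ≤ 2^{m+2}-n}`, where `2^m ≤ n < 2^{m+1}` (i.e. `m = Nat.log 2 n`). -/
def Ispace (S : LSYSetup K) (n : ℕ) : Submodule K (FA K) where
  carrier := {a | a ∈ Aspan K n ∧ ∀ j ≤ 2 ^ (Nat.log 2 n + 2) - n,
      ∀ b ∈ Aspan K j, ∀ c ∈ Aspan K (2 ^ (Nat.log 2 n + 2) - j - n),
      b * a * c ∈ S.U (Nat.log 2 n + 1) * Aspan K (2 ^ (Nat.log 2 n + 1)) ⊔
        Aspan K (2 ^ (Nat.log 2 n + 1)) * S.U (Nat.log 2 n + 1)}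
  add_mem' := by
    rintro a b ⟨ha1, ha2⟩ ⟨hb1, hb2⟩
    refine ⟨add_mem ha1 hb1, fun j hj c hc d hd => ?_⟩
    rw [mul_add, add_mul]
    exact add_mem (ha2 j hj c hc d hd) (hb2 j hj c hc d hd)
  zero_mem' := ⟨zero_mem _, fun j hj c hc d hd => by
    rw [mul_zero, zero_mul]; exact zero_mem _⟩
  smul_mem' := by
    rintro k a ⟨ha1, ha2⟩
    refine ⟨Submodule.smul_mem _ k ha1, fun j hj c hc d hd => ?_⟩
    rw [mul_smul_comm, smul_mul_assoc]
    exact Submodule.smul_mem _ _ (ha2 j hj c hc d hd)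



lemma Aspan_mul (a b : ℕ) : Aspan K a * Aspan K b = Aspan K (a + b) := by
  unfold Aspan
  rw [Submodule.span_mul_span]
  congr 1
  ext x
  constructor
  · rintro ⟨u, ⟨l, hl, rfl⟩, v, ⟨l', hl', rfl⟩, rfl⟩
    exact ⟨l ++ l', by simp [hl, hl'], by simp [wordOf]⟩
  · rintro ⟨l, hl, rfl⟩
    refine ⟨wordOf K (l.take a), ⟨_, by simp [hl], rfl⟩, wordOf K (l.drop a),
      ⟨_, by simp [hl], rfl⟩, ?_⟩
    simp only [wordOf]
    rw [← List.prod_append, ← List.map_append, List.take_append_drop]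

lemma Aspan_zero : Aspan K 0 = 1 := by
  unfold Aspan
  rw [Submodule.one_eq_span]
  congr 1
  ext x
  constructor
  · rintro ⟨l, hl, rfl⟩
    simp [wordOf, List.length_eq_zero_iff.mp hl]
  · rintro rfl
    exact ⟨[], rfl, by simp [wordOf]⟩

instance Aspan_fin (n : ℕ) : Module.Finite K (Aspan K n) := by
  unfold Aspan
  refine Module.Finite.span_of_finite K ?_
  refine ((List.finite_length_eq (Fin 2) n).image (wordOf K)).subset ?_
  rintro x ⟨l, hl, rfl⟩
  exact ⟨l, hl, rfl⟩

/-- Grading homomorphism into polynomials. -/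
def gradHom : FA K →ₐ[K] Polynomial (FA K) :=
  FreeAlgebra.lift K (fun i => Polynomial.monomial 1 (FreeAlgebra.ι K i))

/-- Projection to the degree `n` component. -/
def projA (n : ℕ) : FA K →ₗ[K] FA K :=
  ((Polynomial.lcoeff (FA K) n).restrictScalars K).comp (gradHom (K := K)).toLinearMap

lemma gradHom_word (l : List (Fin 2)) :
    gradHom (wordOf K l) = Polynomial.monomial l.length (wordOf K l) := by
  induction l with
  | nil =>
    simp only [wordOf, List.map_nil, List.prod_nil, map_one, List.length_nil]
    exact Polynomial.monomial_zero_one.symm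
  | cons i l ih =>
    have h : wordOf K (i :: l) = FreeAlgebra.ι K i * wordOf K l := by simp [wordOf]
    rw [h, map_mul, ih]
    simp [gradHom, Polynomial.monomial_mul_monomial, add_comm]

lemma projA_self {n : ℕ} {a : FA K} (ha : a ∈ Aspan K n) : projA n a = a := by
  induction ha using Submodule.span_induction with
  | mem x hx =>
    obtain ⟨l, rfl, rfl⟩ := hx
    simp [projA, gradHom_word]
  | zero => simp
  | add x y _ _ hx hy => rw [map_add, hx, hy]
  | smul c x _ hx => rw [map_smul, hx]

lemma projA_ne {n k : ℕ} (h : n ≠ k) {a : FA K} (ha : a ∈ Aspan K k) : projA n a = 0 := by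
  induction ha using Submodule.span_induction with
  | mem x hx =>
    obtain ⟨l, rfl, rfl⟩ := hx
    simp [projA, gradHom_word, Polynomial.coeff_monomial, h.symm]
  | zero => simp
  | add x y _ _ hx hy => rw [map_add, hx, hy, add_zero]
  | smul c x _ hx => rw [map_smul, hx, smul_zero]

lemma iSup_Aspan : (⨆ n, Aspan K n) = ⊤ := by
  rw [eq_top_iff]
  rintro a -
  induction a using FreeAlgebra.induction with
  | grade0 r =>
    refine Submodule.mem_iSup_of_mem 0 ?_
    rw [Aspan_zero]
    exact Submodule.algebraMap_mem r
  | grade1 i =>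
    exact Submodule.mem_iSup_of_mem 1 (Submodule.subset_span ⟨[i], rfl, by simp [wordOf]⟩)
  | mul a b ha hb =>
    have h := Submodule.mul_mem_mul ha hb
    rw [Submodule.iSup_mul] at h
    refine (iSup_le fun i => ?_ : (⨆ i, Aspan K i * ⨆ n, Aspan K n) ≤ _) h
    rw [Submodule.mul_iSup]
    refine iSup_le fun j => ?_
    rw [Aspan_mul]
    exact le_iSup (Aspan K) (i + j)
  | add a b ha hb => exact add_mem ha hb

/-- `P(q)`. -/
def Pspace (S : LSYSetup K) (q : ℕ) : Submodule K (FA K) :=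
  S.U q * Aspan K (2 ^ q) ⊔ Aspan K (2 ^ q) * S.U q

lemma Pspace_le (S : LSYSetup K) (q : ℕ) : Pspace S q ≤ S.U (q + 1) := by
  unfold Pspace
  rw [sup_comm]
  exact S.hU_mul q

lemma block_U (S : LSYSetup K) (t : ℕ) : ∀ p k l : ℕ, k + 1 + l = 2 ^ t →
    Aspan K (k * 2 ^ p) * S.U p * Aspan K (l * 2 ^ p) ≤ S.U (p + t) := by
  induction t with
  | zero =>
    intro p k l h
    have hk : k = 0 := by simp at h; omega
    have hl : l = 0 := by simp at h; omega
    subst hk hl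
    simp [Aspan_zero]
  | succ t ih =>
    intro p k l h
    rw [pow_succ] at h
    have e : p + (t + 1) = p + 1 + t := by ring
    rw [e]
    rcases Nat.even_or_odd' k with ⟨k', rfl | rfl⟩
    · obtain ⟨l', rfl⟩ : ∃ l', l = 2 * l' + 1 := ⟨(l - 1) / 2, by omega⟩
      have h1 : Aspan K ((2 * l' + 1) * 2 ^ p)
          = Aspan K (2 ^ p) * Aspan K (l' * 2 ^ (p + 1)) := by
        rw [Aspan_mul]; congr 1; ring
      have h2 : 2 * k' * 2 ^ p = k' * 2 ^ (p + 1) := by ring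
      rw [h1, h2]
      calc Aspan K (k' * 2 ^ (p + 1)) * S.U p * (Aspan K (2 ^ p) * Aspan K (l' * 2 ^ (p + 1)))
          = Aspan K (k' * 2 ^ (p + 1)) * (S.U p * Aspan K (2 ^ p)) *
            Aspan K (l' * 2 ^ (p + 1)) := by simp only [mul_assoc]
        _ ≤ Aspan K (k' * 2 ^ (p + 1)) * S.U (p + 1) * Aspan K (l' * 2 ^ (p + 1)) :=
            mul_le_mul' (mul_le_mul' le_rfl (le_sup_right.trans (S.hU_mul p))) le_rfl
        _ ≤ _ := ih (p + 1) k' l' (by omega)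
    · obtain ⟨l', rfl⟩ : ∃ l', l = 2 * l' := ⟨l / 2, by omega⟩
      have h1 : Aspan K ((2 * k' + 1) * 2 ^ p)
          = Aspan K (k' * 2 ^ (p + 1)) * Aspan K (2 ^ p) := by
        rw [Aspan_mul]; congr 1; ring
      have h2 : 2 * l' * 2 ^ p = l' * 2 ^ (p + 1) := by ring
      rw [h1, h2]
      calc Aspan K (k' * 2 ^ (p + 1)) * Aspan K (2 ^ p) * S.U p * Aspan K (l' * 2 ^ (p + 1))
          = Aspan K (k' * 2 ^ (p + 1)) * (Aspan K (2 ^ p) * S.U p) *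
            Aspan K (l' * 2 ^ (p + 1)) := by simp only [mul_assoc]
        _ ≤ Aspan K (k' * 2 ^ (p + 1)) * S.U (p + 1) * Aspan K (l' * 2 ^ (p + 1)) :=
            mul_le_mul' (mul_le_mul' le_rfl (le_sup_left.trans (S.hU_mul p))) le_rfl
        _ ≤ _ := ih (p + 1) k' l' (by omega)

lemma block_P (S : LSYSetup K) (t p k l : ℕ) (h : k + 1 + l = 2 ^ (t + 1)) :
    Aspan K (k * 2 ^ p) * S.U p * Aspan K (l * 2 ^ p) ≤ Pspace S (p + t) := by
  rw [pow_succ] at h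
  by_cases hk : k + 1 ≤ 2 ^ t
  · obtain ⟨l', rfl⟩ : ∃ l', l = l' + 2 ^ t := ⟨l - 2 ^ t, by omega⟩
    have h1 : Aspan K ((l' + 2 ^ t) * 2 ^ p)
        = Aspan K (l' * 2 ^ p) * Aspan K (2 ^ (p + t)) := by
      rw [Aspan_mul]; congr 1; ring
    rw [h1, ← mul_assoc]
    exact le_sup_of_le_left (mul_le_mul' (block_U S t p k l' (by omega)) le_rfl)
  · obtain ⟨k', rfl⟩ : ∃ k', k = 2 ^ t + k' := ⟨k - 2 ^ t, by omega⟩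
    have h1 : Aspan K ((2 ^ t + k') * 2 ^ p)
        = Aspan K (2 ^ (p + t)) * Aspan K (k' * 2 ^ p) := by
      rw [Aspan_mul]; congr 1; ring
    rw [h1, mul_assoc, mul_assoc, ← mul_assoc (Aspan K (k' * 2 ^ p))]
    exact le_sup_of_le_right (mul_le_mul' le_rfl (block_U S t p k' l (by omega)))

/-- `R(n)`, with value zero at `n = 0`. -/
def Rt (S : LSYSetup K) (n : ℕ) : Submodule K (FA K) :=
  if n = 0 then ⊥ else Rspace S n (Nat.log 2 n)

/-- `L(n)`, with value zero at `n = 0`. -/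
def Lt (S : LSYSetup K) (n : ℕ) : Submodule K (FA K) :=
  if n = 0 then ⊥ else Lspace S n (Nat.log 2 n)

lemma log_split {r p : ℕ} (hr : r ≠ 0) (h : r < 2 ^ p) :
    ∃ t, p = Nat.log 2 r + 1 + t ∧
      2 ^ p - r = (2 ^ t - 1) * 2 ^ (Nat.log 2 r + 1) + (2 ^ (Nat.log 2 r + 1) - r) := by
  have h1 : Nat.log 2 r < p := Nat.log_lt_of_lt_pow hr h
  obtain ⟨t, rfl⟩ := Nat.exists_eq_add_of_lt h1
  refine ⟨t, by ring, ?_⟩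
  have h2 : r < 2 ^ (Nat.log 2 r + 1) := Nat.lt_pow_succ_log_self (by norm_num) r
  have h3 : 1 ≤ 2 ^ t := Nat.one_le_two_pow
  obtain ⟨c, hc⟩ := Nat.exists_eq_add_of_le h3
  have h4 : 2 ^ (Nat.log 2 r + t + 1) = c * 2 ^ (Nat.log 2 r + 1) + 2 ^ (Nat.log 2 r + 1) := by
    have : 2 ^ (Nat.log 2 r + t + 1) = 2 ^ t * 2 ^ (Nat.log 2 r + 1) := by ring
    rw [this, hc]; ring
  have h5 : 2 ^ t - 1 = c := by omega
  rw [h4, h5]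
  omega

lemma Rt_U (S : LSYSetup K) {r p : ℕ} (h : r < 2 ^ p) :
    Aspan K (2 ^ p - r) * Rt S r ≤ S.U p := by
  by_cases hr : r = 0
  · simp [Rt, hr]
  obtain ⟨t, hp, he⟩ := log_split hr h
  have h0 : Aspan K (2 ^ (Nat.log 2 r + 1) - r) * Rt S r ≤ S.U (Nat.log 2 r + 1) := by
    rw [Rt, if_neg hr, Submodule.mul_le]
    rintro b hb a ⟨_, ha⟩
    exact ha b hb
  have h1 := block_U S t (Nat.log 2 r + 1) (2 ^ t - 1) 0
    (by have : 1 ≤ 2 ^ t := Nat.one_le_two_pow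
        omega)
  rw [zero_mul, Aspan_zero, mul_one] at h1
  rw [he, ← Aspan_mul, mul_assoc]
  refine le_of_le_of_eq ?_ (congrArg S.U hp.symm)
  exact (mul_le_mul' le_rfl h0).trans h1

lemma Lt_U (S : LSYSetup K) {r p : ℕ} (h : r < 2 ^ p) :
    Lt S r * Aspan K (2 ^ p - r) ≤ S.U p := by
  by_cases hr : r = 0
  · simp [Lt, hr]
  obtain ⟨t, hp, he⟩ := log_split hr h
  have h0 : Lt S r * Aspan K (2 ^ (Nat.log 2 r + 1) - r) ≤ S.U (Nat.log 2 r + 1) := by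
    rw [Lt, if_neg hr, Submodule.mul_le]
    rintro a ⟨_, ha⟩ b hb
    exact ha b hb
  have h1 := block_U S t (Nat.log 2 r + 1) 0 (2 ^ t - 1)
    (by have : 1 ≤ 2 ^ t := Nat.one_le_two_pow
        omega)
  rw [zero_mul, Aspan_zero, one_mul] at h1
  rw [he, add_comm, ← Aspan_mul, ← mul_assoc]
  refine le_of_le_of_eq ?_ (congrArg S.U hp.symm)
  exact (mul_le_mul' h0 le_rfl).trans h1

/-- The spaces `R(r) A(s) + A(r) L(s)`. -/
def Xsp (S : LSYSetup K) (r s : ℕ) : Submodule K (FA K) :=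
  Rt S r * Aspan K s ⊔ Aspan K r * Lt S s

lemma Xsp_good (S : LSYSetup K) (t p j r s d k : ℕ) (hr : r < 2 ^ p) (hs : s < 2 ^ p)
    (hk : j + r = k * 2 ^ p) (hd : j + (r + s) + d = 2 ^ (p + t + 1)) :
    Aspan K j * Xsp S r s * Aspan K d ≤ Pspace S (p + t) := by
  have hc : 2 ^ (p + t + 1) = 2 ^ (t + 1) * 2 ^ p := by ring
  have hpos : 0 < 2 ^ p := by positivity
  have hkc : k ≤ 2 ^ (t + 1) := by
    refine Nat.le_of_mul_le_mul_right ?_ hpos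
    rw [← hk, ← hc]; omega
  obtain ⟨l, hl⟩ := Nat.exists_eq_add_of_le hkc
  have hsd : s + d = l * 2 ^ p := by
    rw [hc, hl, add_mul] at hd
    omega
  unfold Xsp
  rw [Submodule.mul_sup, Submodule.sup_mul]
  refine sup_le ?_ ?_
  · by_cases hr0 : r = 0
    · simp [Rt, hr0]
    obtain ⟨k', rfl⟩ : ∃ k', k = k' + 1 := by
      refine Nat.exists_eq_succ_of_ne_zero ?_
      rintro rfl
      omega
    have hj : j = k' * 2 ^ p + (2 ^ p - r) := by rw [add_mul] at hk; omega
    calc Aspan K j * (Rt S r * Aspan K s) * Aspan K d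
        = Aspan K (k' * 2 ^ p) * (Aspan K (2 ^ p - r) * Rt S r) * Aspan K (l * 2 ^ p) := by
          rw [hj, ← hsd, ← Aspan_mul, ← Aspan_mul]; simp only [mul_assoc]
      _ ≤ Aspan K (k' * 2 ^ p) * S.U p * Aspan K (l * 2 ^ p) :=
          mul_le_mul' (mul_le_mul' le_rfl (Rt_U S hr)) le_rfl
      _ ≤ _ := block_P S t p k' l (by omega)
  · by_cases hs0 : s = 0
    · simp [Lt, hs0]
    obtain ⟨l', rfl⟩ : ∃ l', l = l' + 1 := by
      refine Nat.exists_eq_succ_of_ne_zero ?_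
      rintro rfl
      omega
    have hj : d = (2 ^ p - s) + l' * 2 ^ p := by rw [add_mul] at hsd; omega
    calc Aspan K j * (Aspan K r * Lt S s) * Aspan K d
        = Aspan K (k * 2 ^ p) * (Lt S s * Aspan K (2 ^ p - s)) * Aspan K (l' * 2 ^ p) := by
          rw [hj, ← hk, ← Aspan_mul, ← Aspan_mul]; simp only [mul_assoc]
      _ ≤ Aspan K (k * 2 ^ p) * S.U p * Aspan K (l' * 2 ^ p) :=
          mul_le_mul' (mul_le_mul' le_rfl (Lt_U S hs)) le_rfl
      _ ≤ _ := block_P S t p k l' (by omega)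

/-- The homogeneous components of the ideal. -/
def Igood (S : LSYSetup K) (n : ℕ) : Submodule K (FA K) where
  carrier := {a | a ∈ Aspan K n ∧ ∀ q j d, n < 2 ^ q → j + n + d = 2 ^ (q + 1) →
      ∀ b ∈ Aspan K j, ∀ c ∈ Aspan K d, b * a * c ∈ Pspace S q}
  add_mem' := by
    rintro a b ⟨ha1, ha2⟩ ⟨hb1, hb2⟩
    refine ⟨add_mem ha1 hb1, fun q j d hq hj c hc e he => ?_⟩
    rw [mul_add, add_mul]
    exact add_mem (ha2 q j d hq hj c hc e he) (hb2 q j d hq hj c hc e he)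
  zero_mem' := ⟨zero_mem _, fun q j d hq hj c hc e he => by
    rw [mul_zero, zero_mul]; exact zero_mem _⟩
  smul_mem' := by
    rintro k a ⟨ha1, ha2⟩
    refine ⟨Submodule.smul_mem _ k ha1, fun q j d hq hj c hc e he => ?_⟩
    rw [mul_smul_comm, smul_mul_assoc]
    exact Submodule.smul_mem _ _ (ha2 q j d hq hj c hc e he)

lemma Igood_le (S : LSYSetup K) (n : ℕ) : Igood S n ≤ Aspan K n := fun _ h => h.1

lemma Igood_mul_right (S : LSYSetup K) (n k : ℕ) : Igood S n * Aspan K k ≤ Igood S (n + k) := by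
  rw [Submodule.mul_le]
  rintro a ⟨ha, ha'⟩ r hr
  refine ⟨Aspan_mul (K := K) n k ▸ Submodule.mul_mem_mul ha hr, fun q j d hq hj b hb c hc => ?_⟩
  have := ha' q j (k + d) (by omega) (by omega) b hb (r * c)
    (Aspan_mul (K := K) k d ▸ Submodule.mul_mem_mul hr hc)
  simpa only [mul_assoc] using this

lemma Igood_mul_left (S : LSYSetup K) (n k : ℕ) : Aspan K k * Igood S n ≤ Igood S (k + n) := by
  rw [Submodule.mul_le]
  rintro r hr a ⟨ha, ha'⟩
  refine ⟨Aspan_mul (K := K) k n ▸ Submodule.mul_mem_mul hr ha, fun q j d hq hj b hb c hc => ?_⟩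
  have := ha' q (j + k) d (by omega) (by omega) (b * r)
    (Aspan_mul (K := K) j k ▸ Submodule.mul_mem_mul hb hr) c hc
  simpa only [mul_assoc] using this

/-- The ideal. -/
def Iideal (S : LSYSetup K) : Submodule K (FA K) := ⨆ n, Igood S n

lemma Iideal_mul (S : LSYSetup K) : Iideal S * ⊤ ≤ Iideal S := by
  rw [← iSup_Aspan, Iideal, Submodule.iSup_mul]
  refine iSup_le fun n => ?_
  rw [Submodule.mul_iSup]
  exact iSup_le fun k => (Igood_mul_right S n k).trans (le_iSup (Igood S) _)

lemma Iideal_mul' (S : LSYSetup K) : ⊤ * Iideal S ≤ Iideal S := by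
  rw [← iSup_Aspan, Iideal, Submodule.iSup_mul]
  refine iSup_le fun n => ?_
  rw [Submodule.mul_iSup]
  exact iSup_le fun k => (Igood_mul_left S k n).trans (le_iSup (Igood S) _)

lemma projA_Iideal (S : LSYSetup K) (n : ℕ) {a : FA K} (ha : a ∈ Iideal S) :
    projA n a ∈ Igood S n := by
  have : Iideal S ≤ (Igood S n).comap (projA n) := by
    refine iSup_le fun k a hk => ?_
    rw [Submodule.mem_comap]
    by_cases h : n = k
    · subst h
      rwa [projA_self hk.1]
    · rw [projA_ne h hk.1]
      exact zero_mem _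
  exact this ha

lemma Xsp_Igood (S : LSYSetup K) (n : ℕ) (a : FA K) (ha : a ∈ Aspan K n)
    (h : ∀ j ∈ Finset.range (n + 1), a ∈ Xsp S (n - j) j) : a ∈ Igood S n := by
  have h' : ∀ r s, r + s = n → a ∈ Xsp S r s := by
    intro r s hrs
    have := h s (Finset.mem_range.mpr (by omega))
    rwa [show n - s = r by omega] at this
  by_cases hn : n = 0
  · have := h' 0 0 hn.symm
    simp [Xsp, Rt, Lt] at this
    rw [this]
    exact zero_mem _
  refine ⟨ha, fun q j d hq hj b hb c hc => ?_⟩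
  have key : ∀ p t r s k, q = p + t → r + s = n → r < 2 ^ p → s < 2 ^ p → j + r = k * 2 ^ p →
      b * a * c ∈ Pspace S q := by
    intro p t r s k hp hrs hr hs hk
    subst hp
    refine Xsp_good S t p j r s d k hr hs hk (by rw [hrs, hj]) ?_
    exact Submodule.mul_mem_mul (Submodule.mul_mem_mul hb (h' r s hrs)) hc
  have h1 : n < 2 ^ (Nat.log 2 n + 1) := Nat.lt_pow_succ_log_self (by norm_num) n
  have h2 : 2 ^ Nat.log 2 n ≤ n := Nat.pow_log_le_self 2 hn
  have h3 : Nat.log 2 n < q := Nat.log_lt_of_lt_pow hn hq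
  generalize Nat.log 2 n = m at h1 h2 h3
  have h4 : j % 2 ^ (m + 1) < 2 ^ (m + 1) := Nat.mod_lt _ (by positivity)
  have h5 := Nat.div_add_mod j (2 ^ (m + 1))
  set s := j % 2 ^ (m + 1)
  set u := j / 2 ^ (m + 1)
  have h6 : 2 ^ (m + 1) = 2 * 2 ^ m := by ring
  have h7 : 0 < 2 ^ m := by positivity
  by_cases c1 : s = 0
  · exact key (m + 1) (q - (m + 1)) 0 n u (by omega) (by omega) (by omega) (by omega)
      (by rw [mul_comm]; omega)
  by_cases c2 : 2 ^ (m + 1) ≤ s + n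
  · exact key (m + 1) (q - (m + 1)) (2 ^ (m + 1) - s) (n - (2 ^ (m + 1) - s)) (u + 1)
      (by omega) (by omega) (by omega) (by omega)
      (by rw [add_mul, mul_comm u]; omega)
  · exact key m (q - m) (2 ^ m - s) (n - (2 ^ m - s)) (2 * u + 1)
      (by omega) (by omega) (by omega) (by omega)
      (by rw [show (2 * u + 1) * 2 ^ m = 2 ^ (m + 1) * u + 2 ^ m by ring]; omega)

lemma exists_compl_in {X A : Submodule K (FA K)} (h : X ≤ A) :
    ∃ Y ≤ A, Disjoint X Y ∧ X ⊔ Y = A := by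
  obtain ⟨Y, hY⟩ := Submodule.exists_isCompl X
  refine ⟨Y ⊓ A, inf_le_right, hY.disjoint.mono_right inf_le_left, ?_⟩
  rw [← sup_inf_assoc_of_le Y h, hY.sup_eq_top, top_inf_eq]

lemma finrank_mul_le' (X Y : Submodule K (FA K)) [Module.Finite K X] [Module.Finite K Y] :
    Module.Finite K ↥(X * Y) ∧ finrank K ↥(X * Y) ≤ finrank K X * finrank K Y := by
  rw [← Submodule.mulMap_range, ← finrank_tensorProduct]
  exact ⟨inferInstance, LinearMap.finrank_range_le _⟩

lemma cod_mono {E : Type*} [AddCommGroup E] [Module K E] [Module.Finite K E]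
    {X Y : Submodule K E} (h : X ≤ Y) : finrank K (E ⧸ Y) ≤ finrank K (E ⧸ X) := by
  have h1 := Submodule.finrank_quotient_add_finrank X
  have h2 := Submodule.finrank_quotient_add_finrank Y
  have h3 := Submodule.finrank_mono h
  omega

lemma cod_inf {E : Type*} [AddCommGroup E] [Module K E] [Module.Finite K E]
    (X Y : Submodule K E) :
    finrank K (E ⧸ (X ⊓ Y)) ≤ finrank K (E ⧸ X) + finrank K (E ⧸ Y) := by
  have h1 := Submodule.finrank_quotient_add_finrank X
  have h2 := Submodule.finrank_quotient_add_finrank Y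
  have h3 := Submodule.finrank_quotient_add_finrank (X ⊓ Y)
  have h4 := Submodule.finrank_sup_add_finrank_inf_eq X Y
  have h5 := Submodule.finrank_le (X ⊔ Y)
  omega

lemma cod_iInf {E ι : Type*} [AddCommGroup E] [Module K E] [Module.Finite K E]
    (s : Finset ι) (X : ι → Submodule K E) :
    finrank K (E ⧸ (s.inf X)) ≤ ∑ j ∈ s, finrank K (E ⧸ X j) := by
  classical
  induction s using Finset.induction_on with
  | empty =>
    have h3 := Submodule.finrank_quotient_add_finrank (⊤ : Submodule K E)
    rw [finrank_top] at h3
    rw [Finset.sum_empty]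
    exact (cod_mono (X := ⊤) (by simp)).trans (by omega)
  | insert a s ha ih =>
    rw [Finset.inf_insert, Finset.sum_insert ha]
    exact (cod_inf _ _).trans (by omega)

lemma cod_compl {A X Y : Submodule K (FA K)} [Module.Finite K A]
    (hX : X ≤ A) (hY : Y ≤ A) (h : X ⊔ Y = A) :
    finrank K (A ⧸ X.comap A.subtype) ≤ finrank K Y := by
  have h1 := Submodule.finrank_quotient_add_finrank (X.comap A.subtype)
  have h2 : finrank K (X.comap A.subtype) = finrank K X :=
    (Submodule.comapSubtypeEquivOfLe hX).finrank_eq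
  have : Module.Finite K X := Submodule.finiteDimensional_of_le hX
  have : Module.Finite K Y := Submodule.finiteDimensional_of_le hY
  have h3 := Submodule.finrank_add_le_finrank_add_finrank X Y
  rw [h] at h3
  omega

lemma V_ne (S : LSYSetup K) (n : ℕ) : S.V n ≠ ⊥ := by
  intro h
  have h0 : finrank K (S.V n) = 0 := by rw [h]; exact finrank_bot K _
  by_cases hn : n ∈ Tset S.f S.g
  · obtain ⟨i, hi, h1, h2⟩ := hn
    have h3 := S.hf i hi
    have := S.h_dimV' i (n - (S.f i - S.g i - 1)) (S.f i - S.g i - 1) hi (by omega) (by omega)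
    rw [show S.f i - S.g i - 1 + (n - (S.f i - S.g i - 1)) = n by omega, h0] at this
    exact absurd this.symm (by positivity)
  · have := S.h_dimV n hn
    omega

lemma V_not_le (S : LSYSetup K) (n : ℕ) : ¬ S.V n ≤ Iideal S := by
  intro h
  have h1 : S.V n ≤ Igood S (2 ^ n) := by
    intro a ha
    have := projA_Iideal S (2 ^ n) (h ha)
    rwa [projA_self (S.hV_le n ha)] at this
  have h2 : S.V (n + 2) ≤ S.V n * Aspan K (2 ^ n + 2 ^ (n + 1)) := by
    calc S.V (n + 2) ≤ S.V (n + 1) * S.V (n + 1) := S.hV_mul (n + 1)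
      _ ≤ (S.V n * S.V n) * S.V (n + 1) := mul_le_mul' (S.hV_mul n) le_rfl
      _ ≤ (S.V n * Aspan K (2 ^ n)) * Aspan K (2 ^ (n + 1)) :=
        mul_le_mul' (mul_le_mul' le_rfl (S.hV_le n)) (S.hV_le _)
      _ = _ := by rw [mul_assoc, Aspan_mul]
  have h3 : S.V n * Aspan K (2 ^ n + 2 ^ (n + 1)) ≤ S.U (n + 2) := by
    rw [Submodule.mul_le]
    intro a ha c hc
    have := (h1 ha).2 (n + 1) 0 (2 ^ n + 2 ^ (n + 1))
      (Nat.pow_lt_pow_right (by norm_num) (by omega)) (by ring) 1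
      (by rw [Aspan_zero]; exact Submodule.one_le.mp le_rfl) c hc
    rw [one_mul] at this
    exact Pspace_le S (n + 1) this
  exact V_ne S (n + 2) (disjoint_self.mp ((S.h_disj (n + 2)).mono_left (h2.trans h3)))

lemma inf_codim (S : LSYSetup K) : ¬ Module.Finite K (FA K ⧸ Iideal S) := by
  intro hfin
  have hv : ∀ n, ∃ v ∈ S.V n, v ∉ Iideal S := fun n => by
    simpa [SetLike.not_le_iff_exists] using V_not_le S n
  choose v hv hv' using hv
  have hli : LinearIndependent K (fun n : ℕ => (Iideal S).mkQ (v n)) := by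
    rw [linearIndependent_iff']
    intro s c hc n hn
    by_contra hcn
    apply hv' n
    have h1 : (∑ i ∈ s, c i • v i) ∈ Iideal S := by
      rw [← Submodule.Quotient.mk_eq_zero, ← Submodule.mkQ_apply, map_sum]
      simpa using hc
    have h2 := projA_Iideal S (2 ^ n) h1
    rw [map_sum, Finset.sum_eq_single n] at h2
    · rw [map_smul, projA_self (S.hV_le n (hv n))] at h2
      rw [Submodule.smul_mem_iff _ hcn] at h2
      exact le_iSup (Igood S) _ h2
    · intro i _ hi
      rw [map_smul, projA_ne _ (S.hV_le i (hv i)), smul_zero]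
      exact fun h => hi (Nat.pow_right_injective le_rfl h).symm
    · intro h; exact absurd hn h
  exact not_finite_iff_infinite.mpr (inferInstance : Infinite ℕ) hli.finite

lemma proj_sum (t n : ℕ) (W : Submodule K (FA K)) (hW : W ≤ Aspan K t) (a : FA K)
    (ha : a ∈ Aspan K n) (h : a ∈ ⨆ k : ℕ, Aspan K (k * t) * W * (⊤ : Submodule K (FA K))) :
    a ∈ ⨆ k : ℕ, ⨆ _ : (k + 1) * t ≤ n, Aspan K (k * t) * W * Aspan K (n - (k + 1) * t) := by
  set Z := ⨆ k : ℕ, ⨆ _ : (k + 1) * t ≤ n, Aspan K (k * t) * W * Aspan K (n - (k + 1) * t)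
    with hZ
  have : (⨆ k : ℕ, Aspan K (k * t) * W * (⊤ : Submodule K (FA K))) ≤ Z.comap (projA n) := by
    refine iSup_le fun k => ?_
    rw [← iSup_Aspan, Submodule.mul_iSup]
    refine iSup_le fun r b hb => ?_
    have hb' : b ∈ Aspan K ((k + 1) * t + r) := by
      rw [show (k + 1) * t + r = k * t + t + r by ring, ← Aspan_mul, ← Aspan_mul]
      exact mul_le_mul' (mul_le_mul' le_rfl hW) le_rfl hb
    rw [Submodule.mem_comap]
    by_cases hn : n = (k + 1) * t + r
    · rw [hn, projA_self hb']
      refine Submodule.mem_iSup_of_mem k (Submodule.mem_iSup_of_mem (by omega) ?_)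
      rwa [show n - (k + 1) * t = r by omega]
    · rw [projA_ne hn hb']
      exact zero_mem _
  have := this h
  rwa [Submodule.mem_comap, projA_self ha] at this

lemma J_le (S : LSYSetup K) (i : ℕ) (hi : 1 ≤ i) (J : Submodule K (FA K))
    (hJ : ∀ x ∈ J, ∀ r : FA K, r * x ∈ J ∧ x * r ∈ J)
    (hJ' : J = ⨆ n : ℕ, J ⊓ Aspan K n)
    (h : J ≤ (⨆ k : ℕ, Aspan K (k * 2 ^ S.f i) * S.W i * (⊤ : Submodule K (FA K)))) :
    J ≤ Iideal S := by
  rw [hJ']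
  refine iSup_le fun n => le_iSup_of_le n ?_
  rintro a ⟨haJ, ha⟩
  refine ⟨ha, fun q j d hq hj b hb c hc => ?_⟩
  by_cases hn : n < 2 ^ S.f i
  · have h0 := proj_sum _ n _ (S.hW_le i hi) a ha (h haJ)
    have h1 : a ∈ (⊥ : Submodule K (FA K)) := by
      refine (iSup_le fun k => iSup_le fun hk => ?_ : _ ≤ (⊥ : Submodule K (FA K))) h0
      rw [add_mul] at hk
      omega
    rw [(Submodule.mem_bot K).mp h1]
    simp
  · have hfq : S.f i < q := (Nat.pow_lt_pow_iff_right (by norm_num : 1 < 2)).mp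
      (lt_of_le_of_lt (not_lt.mp hn) hq)
    obtain ⟨t, rfl⟩ := Nat.exists_eq_add_of_le hfq.le
    have hm : b * a * c ∈ Aspan K (2 ^ (S.f i + t + 1)) := by
      rw [← hj, ← Aspan_mul, ← Aspan_mul]
      exact Submodule.mul_mem_mul (Submodule.mul_mem_mul hb ha) hc
    have h0 := proj_sum _ _ _ (S.hW_le i hi) _ hm (h (hJ _ (hJ a haJ b).1 c).2)
    refine (iSup_le fun k => iSup_le fun hk => ?_ : _ ≤ Pspace S (S.f i + t)) h0
    have e : 2 ^ (S.f i + t + 1) = 2 ^ (t + 1) * 2 ^ S.f i := by ring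
    have hk' : k + 1 ≤ 2 ^ (t + 1) := by
      rw [e] at hk
      exact Nat.le_of_mul_le_mul_right hk (by positivity)
    obtain ⟨l, hl⟩ := Nat.exists_eq_add_of_le hk'
    have : 2 ^ (S.f i + t + 1) - (k + 1) * 2 ^ S.f i = l * 2 ^ S.f i := by
      rw [e, hl, add_mul (k + 1)]; omega
    rw [this]
    exact (mul_le_mul' (mul_le_mul' le_rfl (S.hWU i hi)) le_rfl).trans
      (block_P S t (S.f i) k l hl.symm)

lemma Lt_le (S : LSYSetup K) (n : ℕ) : Lt S n ≤ Aspan K n := by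
  unfold Lt
  split_ifs
  · exact bot_le
  · exact fun _ h => h.1

lemma Rt_le (S : LSYSetup K) (n : ℕ) : Rt S n ≤ Aspan K n := by
  unfold Rt
  split_ifs
  · exact bot_le
  · exact fun _ h => h.1

lemma dim_bound (S : LSYSetup K) (L' R' : ℕ → Submodule K (FA K))
    (hL : ∀ n, L' n ≤ Aspan K n) (hR : ∀ n, R' n ≤ Aspan K n)
    (hL' : ∀ n, Lt S n ⊔ L' n = Aspan K n) (hR' : ∀ n, Rt S n ⊔ R' n = Aspan K n) (n : ℕ) :
    finrank K (↥(Aspan K n) ⧸ (Iideal S).comap (Aspan K n).subtype) ≤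
        ∑ j ∈ Finset.range (n + 1), finrank K (L' j) * finrank K (R' (n - j)) := by
  have hle : ((Finset.range (n + 1)).inf fun j => (Xsp S (n - j) j).comap (Aspan K n).subtype)
      ≤ (Iideal S).comap (Aspan K n).subtype := by
    intro a ha
    rw [Submodule.mem_finsetInf] at ha
    exact le_iSup (Igood S) n (Xsp_Igood S n a a.2 ha)
  refine (cod_mono hle).trans ((cod_iInf _ _).trans (Finset.sum_le_sum fun j hj => ?_))
  rw [Finset.mem_range] at hj
  have : Module.Finite K (L' j) := Submodule.finiteDimensional_of_le (hL j)
  have : Module.Finite K (R' (n - j)) := Submodule.finiteDimensional_of_le (hR _)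
  have e : Aspan K n = Aspan K (n - j) * Aspan K j := by
    rw [Aspan_mul]; congr 1; omega
  refine (cod_compl (Y := R' (n - j) * L' j) ?_ ?_ ?_).trans ?_
  · rw [e]
    exact sup_le (mul_le_mul' (Rt_le S _) le_rfl) (mul_le_mul' le_rfl (Lt_le S _))
  · rw [e]
    exact mul_le_mul' (hR _) (hL _)
  · apply le_antisymm
    · rw [e]
      exact sup_le (sup_le (mul_le_mul' (Rt_le S _) le_rfl) (mul_le_mul' le_rfl (Lt_le S _)))
        (mul_le_mul' (hR _) (hL _))
    · rw [e]
      nth_rewrite 1 [← hR' (n - j)]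
      rw [Submodule.sup_mul]
      refine sup_le ?_ ?_
      · exact le_sup_of_le_left le_sup_left
      · nth_rewrite 1 [← hL' j]
        rw [Submodule.mul_sup]
        refine sup_le ?_ le_sup_right
        exact le_sup_of_le_left (le_sup_of_le_right (mul_le_mul' (hR _) le_rfl))
  · rw [mul_comm]
    exact (finrank_mul_le' _ _).2

/-- **Proposition 3.5 (with Corollary 3.4).** There exist a homogeneous two-sided
ideal `I` of `A = K⟨x,y⟩` and subspaces `L'(n), R'(n) ⊆ A(n)` with
`L(n) ⊕ L'(n) = R(n) ⊕ R'(n) = A(n)` for all `n ≥ 1` (and `L'(0) = R'(0) = A(0)`),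
such that: (1) any homogeneous ideal `J ⊆ Σ_k A(k·2^{f(i)})·W_i·A` is contained in `I`;
(2) `V(2^n) ⊄ I` for every `n`; (3) `I` has infinite codimension; and
(4) `dim A(n)/(I ∩ A(n)) ≤ Σ_{j=0}^n dim L'(j) · dim R'(n-j)` for every `n`. -/
theorem proposition_3_5 (S : LSYSetup K) :
    ∃ (I : Submodule K (FA K)) (L' R' : ℕ → Submodule K (FA K)),
      -- `I` is a two-sided ideal
      (∀ x ∈ I, ∀ r : FA K, r * x ∈ I ∧ x * r ∈ I) ∧
      -- `I` is homogeneous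
      (I = ⨆ n : ℕ, I ⊓ Aspan K n) ∧
      -- the complements `L'(n)` and `R'(n)`
      L' 0 = Aspan K 0 ∧ R' 0 = Aspan K 0 ∧
      (∀ n, 1 ≤ n → L' n ≤ Aspan K n ∧ R' n ≤ Aspan K n ∧
        Disjoint (Lspace S n (Nat.log 2 n)) (L' n) ∧
        Lspace S n (Nat.log 2 n) ⊔ L' n = Aspan K n ∧
        Disjoint (Rspace S n (Nat.log 2 n)) (R' n) ∧
        Rspace S n (Nat.log 2 n) ⊔ R' n = Aspan K n) ∧
      -- (1) any homogeneous ideal `J ⊆ Σ_k A(k·2^{f(i)})·W_i·A` satisfies `J ⊆ I`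
      (∀ i, 1 ≤ i → ∀ J : Submodule K (FA K),
        (∀ x ∈ J, ∀ r : FA K, r * x ∈ J ∧ x * r ∈ J) →
        (J = ⨆ n : ℕ, J ⊓ Aspan K n) →
        J ≤ (⨆ k : ℕ, Aspan K (k * 2 ^ S.f i) * S.W i * (⊤ : Submodule K (FA K))) →
        J ≤ I) ∧
      -- (2) `V(2^n) ⊄ I`
      (∀ n : ℕ, ¬ S.V n ≤ I) ∧
      -- (3) `I` has infinite codimension
      (¬ Module.Finite K (FA K ⧸ I)) ∧
      -- (4) the dimension bound
      (∀ n : ℕ, finrank K (↥(Aspan K n) ⧸ I.comap (Aspan K n).subtype) ≤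
        ∑ j ∈ Finset.range (n + 1), finrank K (L' j) * finrank K (R' (n - j))) := by
  have hL : ∀ n, ∃ Y ≤ Aspan K n, Disjoint (Lt S n) Y ∧ Lt S n ⊔ Y = Aspan K n :=
    fun n => exists_compl_in (Lt_le S n)
  have hR : ∀ n, ∃ Y ≤ Aspan K n, Disjoint (Rt S n) Y ∧ Rt S n ⊔ Y = Aspan K n :=
    fun n => exists_compl_in (Rt_le S n)
  choose L' hL1 hL2 hL3 using hL
  choose R' hR1 hR2 hR3 using hR
  refine ⟨Iideal S, L', R', ?_, ?_, ?_, ?_, ?_, J_le S, V_not_le S, inf_codim S,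
    dim_bound S L' R' hL1 hR1 hL3 hR3⟩
  · exact fun x hx r => ⟨Iideal_mul' S (Submodule.mul_mem_mul Submodule.mem_top hx),
      Iideal_mul S (Submodule.mul_mem_mul hx Submodule.mem_top)⟩
  · refine le_antisymm (iSup_le fun n => le_iSup_of_le n ?_) (iSup_le fun n => inf_le_left)
    exact le_inf (le_iSup (Igood S) n) (Igood_le S n)
  · simpa [Lt] using hL3 0
  · simpa [Rt] using hR3 0
  · intro n hn
    have h1 := hL2 n
    have h2 := hL3 n
    have h3 := hR2 n
    have h4 := hR3 n
    rw [Lt, if_neg (by omega)] at h1 h2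
    rw [Rt, if_neg (by omega)] at h3 h4
    exact ⟨hL1 n, hR1 n, h1, h2, h3, h4⟩

end
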